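/- Let P be a poset, K a field, let Λ and Γ be translations on P, and let A, B, C, D be representations of P over K. Suppose (φ, ψ) is a (Λ,Γ)-interleaving between A ⊕ B and C ⊕ D, and suppose there is no nonzero morphism of representations from A to DΛ and no nonzero morphism from C to BΓ. Then A and C are (Λ,Γ)-interleaved, and B and D are (Λ,Γ)-interleaved. -/

import Mathlib

namespace GPM

/-- A translation on a preorder: a monotone map `Λ` with `x ≤ Λ x` for all `x`. -/
structure Translation (Q : Type*) [Preorder Q] where
  toFun : Q → Q
  mono : Monotone toFun
  le_apply : ∀ x, x ≤ toFun x

/-- A representation of a poset `P` with values in `K`-vector spaces. -/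
structure Rep (P : Type*) [Preorder P] (K : Type*) [Field K] where
  V : P → Type*
  [addCommGroup : ∀ p, AddCommGroup (V p)]
  [module : ∀ p, Module K (V p)]
  map : ∀ {p q : P}, p ≤ q → V p →ₗ[K] V q
  map_refl : ∀ p : P, map (le_refl p) = LinearMap.id
  map_comp : ∀ {p q r : P} (hpq : p ≤ q) (hqr : q ≤ r),
      (map hqr).comp (map hpq) = map (hpq.trans hqr)

attribute [instance] Rep.addCommGroup Rep.module

/-- A morphism of representations (a natural transformation). -/
structure RepHom {P : Type*} [Preorder P] {K : Type*} [Field K] (M N : Rep P K) where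
  app : ∀ p, M.V p →ₗ[K] N.V p
  natural : ∀ {p q : P} (h : p ≤ q), (N.map h).comp (app p) = (app q).comp (M.map h)

/-- The shift `MΛ : p ↦ M(Λ p)` of a representation by a translation. -/
def Rep.shift {P : Type*} [Preorder P] {K : Type*} [Field K]
    (M : Rep P K) (Λ : Translation P) : Rep P K where
  V p := M.V (Λ.toFun p)
  map h := M.map (Λ.mono h)
  map_refl p := M.map_refl (Λ.toFun p)
  map_comp h1 h2 := M.map_comp (Λ.mono h1) (Λ.mono h2)

/-- `(φ, ψ)` is a `(Λ, Γ)`-interleaving between `F` and `G`: `φ : F → GΛ`, `ψ : G → FΓ`,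
`ψΛ ∘ φ` is the canonical morphism `F → FΓΛ` and `φΓ ∘ ψ` is the canonical morphism
`G → GΛΓ`. -/
def IsInterleaving {P : Type*} [Preorder P] {K : Type*} [Field K]
    (Λ Γ : Translation P) (F G : Rep P K)
    (φ : RepHom F (G.shift Λ)) (ψ : RepHom G (F.shift Γ)) : Prop :=
  (∀ p, (ψ.app (Λ.toFun p)).comp (φ.app p)
      = F.map ((Λ.le_apply p).trans (Γ.le_apply (Λ.toFun p)))) ∧
  (∀ p, (φ.app (Γ.toFun p)).comp (ψ.app p)
      = G.map ((Γ.le_apply p).trans (Λ.le_apply (Γ.toFun p))))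

/-- `F` and `G` are `(Λ, Γ)`-interleaved. -/
def Interleaved {P : Type*} [Preorder P] {K : Type*} [Field K]
    (Λ Γ : Translation P) (F G : Rep P K) : Prop :=
  ∃ φ ψ, IsInterleaving Λ Γ F G φ ψ

/-- Direct sum of two representations. -/
def Rep.dsum {P : Type*} [Preorder P] {K : Type*} [Field K] (M N : Rep P K) : Rep P K where
  V p := M.V p × N.V p
  map h := (M.map h).prodMap (N.map h)
  map_refl p := by
    apply LinearMap.ext
    intro x
    simp [M.map_refl, N.map_refl]
  map_comp h1 h2 := by
    apply LinearMap.ext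
    intro x
    have hm := congrArg (fun f => f x.1) (M.map_comp h1 h2)
    have hn := congrArg (fun f => f x.2) (N.map_comp h1 h2)
    simp only [LinearMap.comp_apply] at hm hn
    simp [hm, hn]

/-- Composition of morphisms of representations. -/
def RepHom.comp {P : Type*} [Preorder P] {K : Type*} [Field K] {L M N : Rep P K}
    (g : RepHom M N) (f : RepHom L M) : RepHom L N where
  app p := (g.app p).comp (f.app p)
  natural h := by
    rw [← LinearMap.comp_assoc, g.natural h, LinearMap.comp_assoc, f.natural h,
      LinearMap.comp_assoc]

/-- The inclusion of the first summand. -/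
def Rep.inl {P : Type*} [Preorder P] {K : Type*} [Field K] (M N : Rep P K) :
    RepHom M (M.dsum N) where
  app p := LinearMap.inl K (M.V p) (N.V p)
  natural h := LinearMap.ext fun _ => Prod.ext rfl (map_zero (N.map h))

/-- The inclusion of the second summand. -/
def Rep.inr {P : Type*} [Preorder P] {K : Type*} [Field K] (M N : Rep P K) :
    RepHom N (M.dsum N) where
  app p := LinearMap.inr K (M.V p) (N.V p)
  natural h := LinearMap.ext fun _ => Prod.ext (map_zero (M.map h)) rfl

/-- The projection to the first summand. -/
def Rep.fst {P : Type*} [Preorder P] {K : Type*} [Field K] (M N : Rep P K) :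
    RepHom (M.dsum N) M where
  app p := LinearMap.fst K (M.V p) (N.V p)
  natural _ := rfl

/-- The projection to the second summand. -/
def Rep.snd {P : Type*} [Preorder P] {K : Type*} [Field K] (M N : Rep P K) :
    RepHom (M.dsum N) N where
  app p := LinearMap.snd K (M.V p) (N.V p)
  natural _ := rfl

/-- The diagonal blocks of a composite of two upper triangular linear maps are the composites
of the diagonal blocks. -/
theorem diagonal_blocks_of_comp_eq_prodMap {K : Type*} [Field K]
    {A B C D A' B' : Type*} [AddCommGroup A] [Module K A] [AddCommGroup B] [Module K B]
    [AddCommGroup C] [Module K C] [AddCommGroup D] [Module K D]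
    [AddCommGroup A'] [Module K A'] [AddCommGroup B'] [Module K B']
    (f : A × B →ₗ[K] C × D) (g : C × D →ₗ[K] A' × B') (a : A →ₗ[K] A') (b : B →ₗ[K] B')
    (hgf : g.comp f = a.prodMap b)
    (hf : (LinearMap.snd K C D).comp (f.comp (LinearMap.inl K A B)) = 0)
    (hg : (LinearMap.snd K A' B').comp (g.comp (LinearMap.inl K C D)) = 0) :
    ((LinearMap.fst K A' B').comp (g.comp (LinearMap.inl K C D))).comp
        ((LinearMap.fst K C D).comp (f.comp (LinearMap.inl K A B))) = a ∧
      ((LinearMap.snd K A' B').comp (g.comp (LinearMap.inr K C D))).comp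
        ((LinearMap.snd K C D).comp (f.comp (LinearMap.inr K A B))) = b := by
  constructor
  · ext x
    have hx : f (x, 0) = ((f (x, 0)).1, 0) := Prod.ext rfl (LinearMap.congr_fun hf x)
    have hgx := congrArg Prod.fst (LinearMap.congr_fun hgf (x, 0))
    simp only [LinearMap.comp_apply, LinearMap.prodMap_apply] at hgx
    rw [hx] at hgx
    exact hgx
  · ext y
    have hy : f (0, y) = ((f (0, y)).1, 0) + (0, (f (0, y)).2) := by simp
    have hgy := congrArg Prod.snd (LinearMap.congr_fun hgf (0, y))
    have hz : (g ((f (0, y)).1, 0)).2 = 0 := LinearMap.congr_fun hg (f (0, y)).1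
    simp only [LinearMap.comp_apply, LinearMap.prodMap_apply] at hgy
    rw [hy, map_add, Prod.snd_add, hz, zero_add] at hgy
    exact hgy

/-- If `(φ, ψ)` is a `(Λ,Γ)`-interleaving between `A ⊕ B` and
`C ⊕ D`, and there is no nonzero morphism `A → DΛ` nor `C → BΓ`, then `A`, `C` are
`(Λ,Γ)`-interleaved and `B`, `D` are `(Λ,Γ)`-interleaved. -/
theorem statement14 {P : Type*} [PartialOrder P] {K : Type*} [Field K]
    (Λ Γ : Translation P) (A B C D : Rep P K)
    (φ : RepHom (A.dsum B) ((C.dsum D).shift Λ))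
    (ψ : RepHom (C.dsum D) ((A.dsum B).shift Γ))
    (h : IsInterleaving Λ Γ (A.dsum B) (C.dsum D) φ ψ)
    (hAD : ∀ f : RepHom A (D.shift Λ), ∀ p, f.app p = 0)
    (hCB : ∀ f : RepHom C (B.shift Γ), ∀ p, f.app p = 0) :
    Interleaved Λ Γ A C ∧ Interleaved Λ Γ B D := by
  have hφ := hAD (((C.shift Λ).snd (D.shift Λ)).comp (RepHom.comp φ (A.inl B)))
  have hψ := hCB (((A.shift Γ).snd (B.shift Γ)).comp (RepHom.comp ψ (C.inl D)))
  have hF := fun p => diagonal_blocks_of_comp_eq_prodMap _ _ _ _ (h.1 p) (hφ p) (hψ (Λ.toFun p))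
  have hG := fun p => diagonal_blocks_of_comp_eq_prodMap _ _ _ _ (h.2 p) (hψ p) (hφ (Γ.toFun p))
  exact ⟨⟨((C.shift Λ).fst (D.shift Λ)).comp (RepHom.comp φ (A.inl B)),
      ((A.shift Γ).fst (B.shift Γ)).comp (RepHom.comp ψ (C.inl D)),
      fun p => (hF p).1, fun p => (hG p).1⟩,
    ⟨((C.shift Λ).snd (D.shift Λ)).comp (RepHom.comp φ (A.inr B)),
      ((A.shift Γ).snd (B.shift Γ)).comp (RepHom.comp ψ (C.inr D)),
      fun p => (hF p).2, fun p => (hG p).2⟩⟩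

end GPM
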